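/- arXiv:1904.02076 — 2 statements merged into one kernel-verified Lean document; each statement's English description precedes it below -/
import Mathlib

section
/- For every error configuration E ⊆ Fin (n+1) × Fin (m+1), the minimum cardinality I(E) of a feedback repair set satisfies I(E) ≤ n·m, and equality holds if and only if E consists of all N = (n+1)(m+1) cells of the grid. -/
open Filter Topology

/-- A configuration `E` of cells in the `(n+1) × (m+1)` grid is *good* if every nonempty
subset of `E` contains a cell that is the unique cell of the subset in its row,
or the unique cell of the subset in its column. -/
def IsGood (n m : ℕ) (E : Finset (Fin (n + 1) × Fin (m + 1))) : Prop :=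
  ∀ E'' ⊆ E, E''.Nonempty →
    ∃ c ∈ E'', (∀ c' ∈ E'', c'.1 = c.1 → c' = c) ∨ (∀ c' ∈ E'', c'.2 = c.2 → c' = c)

/-- The coordinates graph of a configuration: the bipartite graph on rows ⊕ columns where
row `i` is adjacent to column `j` iff `(i, j) ∈ E`. -/
def coordGraph (n m : ℕ) (E : Finset (Fin (n + 1) × Fin (m + 1))) :
    SimpleGraph (Fin (n + 1) ⊕ Fin (m + 1)) :=
  SimpleGraph.fromRel (fun u v => ∃ i j, u = Sum.inl i ∧ v = Sum.inr j ∧ (i, j) ∈ E)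

/-- Total number of connected components of the coordinates graph (isolated vertices included). -/
noncomputable def Ncc (n m : ℕ) (E : Finset (Fin (n + 1) × Fin (m + 1))) : ℕ :=
  Nat.card (coordGraph n m E).ConnectedComponent

/-- Number of connected components of the coordinates graph containing at least one edge. -/
noncomputable def Nnscc (n m : ℕ) (E : Finset (Fin (n + 1) × Fin (m + 1))) : ℕ :=
  Set.ncard {c : (coordGraph n m E).ConnectedComponent |
    ∃ u v, (coordGraph n m E).Adj u v ∧ (coordGraph n m E).connectedComponentMk u = c}

/-- Number of rows containing at least one cell of `E`. -/
def rowCount (n m : ℕ) (E : Finset (Fin (n + 1) × Fin (m + 1))) : ℕ :=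
  (E.image Prod.fst).card

/-- Number of columns containing at least one cell of `E`. -/
def colCount (n m : ℕ) (E : Finset (Fin (n + 1) × Fin (m + 1))) : ℕ :=
  (E.image Prod.snd).card

/-- `I(E)`: minimum cardinality of a feedback repair set of `E`, i.e. of a subset
`E' ⊆ E` such that `E \ E'` is a good configuration. -/
noncomputable def minFRS (n m : ℕ) (E : Finset (Fin (n + 1) × Fin (m + 1))) : ℕ :=
  sInf {k | ∃ E' ⊆ E, IsGood n m (E \ E') ∧ E'.card = k}

theorem IsGood.mono' {n m : ℕ} {A B : Finset (Fin (n + 1) × Fin (m + 1))}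
    (h : IsGood n m B) (hAB : A ⊆ B) : IsGood n m A :=
  fun E'' hE hne => h E'' (hE.trans hAB) hne

theorem good_card {n m : ℕ} (k : ℕ) : ∀ F : Finset (Fin (n + 1) × Fin (m + 1)),
    F.card = k → IsGood n m F → F.Nonempty → F.card + 1 ≤ rowCount n m F + colCount n m F := by
  induction k with
  | zero =>
    intro F hk _ hne
    have := hne.card_pos
    omega
  | succ k ih =>
    intro F hk hF hne
    obtain ⟨c, hc, h⟩ := hF F subset_rfl hne
    have hr : 1 ≤ rowCount n m F := (hne.image _).card_pos
    have hcl : 1 ≤ colCount n m F := (hne.image _).card_pos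
    have hce : (F.erase c).card = k := by rw [Finset.card_erase_of_mem hc]; omega
    by_cases he : (F.erase c).Nonempty
    · have := ih _ hce (hF.mono' (Finset.erase_subset _ _)) he
      have r1 : rowCount n m (F.erase c) ≤ rowCount n m F :=
        Finset.card_le_card (Finset.image_subset_image (Finset.erase_subset _ _))
      have c1 : colCount n m (F.erase c) ≤ colCount n m F :=
        Finset.card_le_card (Finset.image_subset_image (Finset.erase_subset _ _))
      rcases h with h | h
      · have : rowCount n m (F.erase c) < rowCount n m F := by
          apply Finset.card_lt_card
          refine (Finset.ssubset_iff_of_subset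
            (Finset.image_subset_image (Finset.erase_subset _ _))).2
            ⟨c.1, Finset.mem_image_of_mem _ hc, ?_⟩
          intro hm
          obtain ⟨d, hd, hd2⟩ := Finset.mem_image.1 hm
          exact (Finset.mem_erase.1 hd).1 (h d (Finset.mem_erase.1 hd).2 hd2)
        omega
      · have : colCount n m (F.erase c) < colCount n m F := by
          apply Finset.card_lt_card
          refine (Finset.ssubset_iff_of_subset
            (Finset.image_subset_image (Finset.erase_subset _ _))).2
            ⟨c.2, Finset.mem_image_of_mem _ hc, ?_⟩
          intro hm
          obtain ⟨d, hd, hd2⟩ := Finset.mem_image.1 hm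
          exact (Finset.mem_erase.1 hd).1 (h d (Finset.mem_erase.1 hd).2 hd2)
        omega
    · rw [Finset.not_nonempty_iff_eq_empty] at he
      rw [he] at hce
      simp at hce
      omega

/-- complement of the cross through `(a, b)` -/
def crossCompl (n m : ℕ) (a : Fin (n + 1)) (b : Fin (m + 1)) :
    Finset (Fin (n + 1) × Fin (m + 1)) :=
  (Finset.univ.erase a) ×ˢ (Finset.univ.erase b)

theorem crossCompl_card (n m : ℕ) (a : Fin (n + 1)) (b : Fin (m + 1)) :
    (crossCompl n m a b).card = n * m := by
  simp [crossCompl, Finset.card_product, Finset.card_erase_of_mem]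

theorem cross_good (n m : ℕ) (a : Fin (n + 1)) (b : Fin (m + 1))
    (F : Finset (Fin (n + 1) × Fin (m + 1))) (hF : ∀ c ∈ F, c.1 = a ∨ c.2 = b) :
    IsGood n m F := by
  intro E hE hne
  by_cases h : ∃ c ∈ E, c.1 ≠ a
  · obtain ⟨c, hc, hca⟩ := h
    refine ⟨c, hc, Or.inl fun c' hc' he => Prod.ext he ?_⟩
    have h1 := (hF c (hE hc)).resolve_left hca
    have h2 := (hF c' (hE hc')).resolve_left (he ▸ hca)
    rw [h1, h2]
  · push Not at h
    obtain ⟨c, hc⟩ := hne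
    exact ⟨c, hc, Or.inr fun c' hc' he => Prod.ext ((h c' hc').trans (h c hc).symm) he⟩

theorem minFRS_le_cross (n m : ℕ) (a : Fin (n + 1)) (b : Fin (m + 1))
    (E : Finset (Fin (n + 1) × Fin (m + 1))) :
    minFRS n m E ≤ (E ∩ crossCompl n m a b).card := by
  refine Nat.sInf_le ⟨_, Finset.inter_subset_left, cross_good n m a b _ ?_, rfl⟩
  intro c hc
  simp only [crossCompl, Finset.mem_sdiff, Finset.mem_inter, Finset.mem_product,
    Finset.mem_erase, Finset.mem_univ] at hc
  tauto

/-- `I(E) ≤ n·m`, with equality if and only if `E` consists of all `(n+1)(m+1)` cells. -/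
theorem minFRS_le_and_eq_iff (n m : ℕ) (hn : 1 ≤ n) (hm : 1 ≤ m)
    (E : Finset (Fin (n + 1) × Fin (m + 1))) :
    minFRS n m E ≤ n * m ∧ (minFRS n m E = n * m ↔ E = Finset.univ) := by
  have hle : minFRS n m E ≤ n * m :=
    (minFRS_le_cross n m 0 0 E).trans
      ((Finset.card_le_card Finset.inter_subset_right).trans (crossCompl_card n m 0 0).le)
  refine ⟨hle, ?_, ?_⟩
  · intro heq
    by_contra hne
    obtain ⟨c, hc⟩ : ∃ c, c ∉ E := by
      by_contra hall
      push Not at hall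
      exact hne (Finset.eq_univ_of_forall hall)
    haveI : Nontrivial (Fin (n + 1)) := Fin.nontrivial_iff_two_le.2 (by omega)
    haveI : Nontrivial (Fin (m + 1)) := Fin.nontrivial_iff_two_le.2 (by omega)
    obtain ⟨a, ha⟩ := exists_ne c.1
    obtain ⟨b, hb⟩ := exists_ne c.2
    have h1 := minFRS_le_cross n m a b E
    have h2 : (E ∩ crossCompl n m a b).card < (crossCompl n m a b).card := by
      apply Finset.card_lt_card
      refine (Finset.ssubset_iff_of_subset Finset.inter_subset_right).2 ⟨c, ?_, ?_⟩
      · simp [crossCompl, ha.symm, hb.symm]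
      · simp [hc]
    rw [crossCompl_card] at h2
    omega
  · rintro rfl
    refine le_antisymm hle (le_csInf ⟨_, Finset.univ, subset_rfl, ?_, rfl⟩ ?_)
    · exact cross_good n m 0 0 _ (by simp)
    · rintro k ⟨E', hE', hg, rfl⟩
      have hcard : (Finset.univ \ E').card + E'.card = (n + 1) * (m + 1) := by
        rw [Finset.card_sdiff_add_card_eq_card hE']
        simp
      have hF : (Finset.univ \ E').card ≤ n + m + 1 := by
        by_cases hne : (Finset.univ \ E').Nonempty
        · have := good_card _ _ rfl hg hne
          have r : rowCount n m (Finset.univ \ E') ≤ n + 1 :=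
            (Finset.card_le_univ _).trans (by simp)
          have c : colCount n m (Finset.univ \ E') ≤ m + 1 :=
            (Finset.card_le_univ _).trans (by simp)
          omega
        · rw [Finset.not_nonempty_iff_eq_empty] at hne
          simp [hne]
      nlinarith
end

section
/- For every integer e with 0 ≤ e ≤ N, the number of good error configurations with exactly e cells equals the number of e-cell configurations E for which the coordinates graph G_E is acyclic, i.e. the number of e-edge spanning forests (acyclic partial subgraphs with e edges) of the complete bipartite graph K_{n+1,m+1}. -/
open Filter Topology

lemma coordGraph_adj_lr (n m : ℕ) (E : Finset (Fin (n + 1) × Fin (m + 1))) (i j) :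
    (coordGraph n m E).Adj (Sum.inl i) (Sum.inr j) ↔ (i, j) ∈ E := by
  simp [coordGraph]

lemma coordGraph_not_ll (n m : ℕ) (E : Finset (Fin (n + 1) × Fin (m + 1))) (i j) :
    ¬ (coordGraph n m E).Adj (Sum.inl i) (Sum.inl j) := by
  simp [coordGraph]

lemma coordGraph_not_rr (n m : ℕ) (E : Finset (Fin (n + 1) × Fin (m + 1))) (i j) :
    ¬ (coordGraph n m E).Adj (Sum.inr i) (Sum.inr j) := by
  simp [coordGraph]

lemma coordGraph_mono (n m : ℕ) {E F : Finset (Fin (n + 1) × Fin (m + 1))} (h : E ⊆ F) :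
    coordGraph n m E ≤ coordGraph n m F := by
  rintro (a | a) (b | b) hab
  · exact absurd hab (coordGraph_not_ll _ _ _ _ _)
  · rw [coordGraph_adj_lr] at *; exact h hab
  · rw [SimpleGraph.adj_comm, coordGraph_adj_lr] at *; exact h hab
  · exact absurd hab (coordGraph_not_rr _ _ _ _ _)

lemma exists_leaf {V : Type*} [Finite V] (G : SimpleGraph V) (h : G.IsAcyclic)
    {a b : V} (hab : G.Adj a b) : ∃ u v, G.Adj u v ∧ ∀ w, G.Adj u w → w = v := by
  have : Nonempty V := ⟨a⟩
  have ⟨u, v, p, hp, hmax⟩ := SimpleGraph.Walk.exists_isPath_forall_isPath_length_le_length G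
  have hnil : ¬p.Nil := by
    have := hmax _ _ _ (SimpleGraph.Path.singleton hab).2
    rw [SimpleGraph.Walk.not_nil_iff_lt_length]
    simp [SimpleGraph.Path.singleton] at this
    omega
  refine ⟨u, _, p.adj_snd hnil, fun w hadj ↦ ?_⟩
  apply h.eq_snd_of_adj_start hp hadj
  by_contra hw
  have := hmax _ _ _ (hp.cons hw (h := hadj.symm))
  simp at this

lemma isGood_iff (n m : ℕ) (E : Finset (Fin (n + 1) × Fin (m + 1))) :
    IsGood n m E ↔ (coordGraph n m E).IsAcyclic := by
  classical
  constructor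
  · intro hg v p hp
    have hc := hp.isCycles_spanningCoe_toSubgraph
    set H := p.toSubgraph.spanningCoe with hH
    have hle : H ≤ coordGraph n m E := SimpleGraph.Subgraph.spanningCoe_le _
    have hmem : ∀ c, c ∈ E.filter (fun c => H.Adj (Sum.inl c.1) (Sum.inr c.2)) ↔
        H.Adj (Sum.inl c.1) (Sum.inr c.2) := by
      intro c
      simp only [Finset.mem_filter, and_iff_right_iff_imp]
      intro h
      exact (coordGraph_adj_lr ..).1 (hle h)
    obtain ⟨c, hcm, h⟩ := hg (E.filter (fun c => H.Adj (Sum.inl c.1) (Sum.inr c.2)))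
      (Finset.filter_subset _ _) (by
        have h1 : H.Adj v p.snd := p.toSubgraph_adj_snd hp.not_nil
        generalize p.snd = w at h1
        clear_value H
        clear hH hp p
        rcases v with a | a <;> rcases w with b | b
        · exact absurd (hle h1) (coordGraph_not_ll _ _ _ _ _)
        · exact ⟨(a, b), (hmem _).2 h1⟩
        · exact ⟨(b, a), (hmem _).2 h1.symm⟩
        · exact absurd (hle h1) (coordGraph_not_rr _ _ _ _ _))
    rw [hmem] at hcm
    rcases h with h | h
    · obtain ⟨w, hw, ha⟩ := hc.other_adj_of_adj hcm
      rcases w with w | w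
      · exact absurd (hle ha) (coordGraph_not_ll _ _ _ _ _)
      · have := h (c.1, w) ((hmem _).2 ha) rfl
        exact hw (by rw [← this])
    · obtain ⟨w, hw, ha⟩ := hc.other_adj_of_adj hcm.symm
      rcases w with w | w
      · have := h (w, c.2) ((hmem _).2 ha.symm) rfl
        exact hw (by rw [← this])
      · exact absurd (hle ha) (coordGraph_not_rr _ _ _ _ _)
  · intro h F hF ⟨c, hc⟩
    obtain ⟨u, v, huv, hu⟩ := exists_leaf _ (h.anti (coordGraph_mono n m hF))
      ((coordGraph_adj_lr n m F c.1 c.2).2 hc)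
    rcases u with a | a <;> rcases v with b | b
    · exact absurd huv (coordGraph_not_ll _ _ _ _ _)
    · refine ⟨(a, b), (coordGraph_adj_lr ..).1 huv, Or.inl ?_⟩
      rintro ⟨x, y⟩ hxy rfl
      have := hu _ ((coordGraph_adj_lr ..).2 hxy)
      simp_all
    · refine ⟨(b, a), (coordGraph_adj_lr ..).1 huv.symm, Or.inr ?_⟩
      rintro ⟨x, y⟩ hxy rfl
      have := hu _ ((coordGraph_adj_lr ..).2 hxy).symm
      simp_all
    · exact absurd huv (coordGraph_not_rr _ _ _ _ _)

/-- The number of good error configurations with exactly `e` cells equals the number of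
`e`-cell configurations whose coordinates graph is acyclic, i.e. the number of `e`-edge
partial forests of the complete bipartite graph `K_{n+1,m+1}`. -/
theorem card_good_eq_card_forests (n m : ℕ) (hn : 1 ≤ n) (hm : 1 ≤ m) (e : ℕ)
    (he : e ≤ (n + 1) * (m + 1)) :
    {E : Finset (Fin (n + 1) × Fin (m + 1)) | E.card = e ∧ IsGood n m E}.ncard =
      {E : Finset (Fin (n + 1) × Fin (m + 1)) |
        E.card = e ∧ (coordGraph n m E).IsAcyclic}.ncard := by
  simp only [isGood_iff]
end
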